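/- arXiv:1309.2682 — 3 statements merged into one kernel-verified Lean document; each statement's English description precedes it below -/
import Mathlib

section
/- Let κ = 2. For every positive integer n and every non-negative integer m, β(n, m) equals the smallest non-negative integer b such that the box [0,b]^n contains every tuple (x_1,...,x_n) ∈ {0,...,m}^n which has no duplicate in {0,...,m}^n \ {(x_1,...,x_n)}. -/
/-- An equation from `E_n`: one of `x k = 1`, `x i + x j = x k`, `x i * x j = x k`
with `i, j, k ∈ {1, ..., n}` (indices are represented by `Fin n`). -/
inductive Eqn (n : ℕ) where
  | one (k : Fin n)
  | add (i j k : Fin n)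
  | mul (i j k : Fin n)

/-- A tuple satisfies a single equation. -/
def Eqn.Holds {n : ℕ} (x : Fin n → ℕ) : Eqn n → Prop
  | .one k => x k = 1
  | .add i j k => x i + x j = x k
  | .mul i j k => x i * x j = x k

/-- A tuple solves a system `S ⊆ E_n`. -/
def Solves {n : ℕ} (S : Set (Eqn n)) (x : Fin n → ℕ) : Prop :=
  ∀ e ∈ S, e.Holds x

/-- With `κ = 2`: `beta n m` is the smallest `b` such that for each system
`S ⊆ E_n` with exactly one solution in `{0, ..., m}^n`, that solution belongs to
`[0, b]^n`. -/
noncomputable def beta (n m : ℕ) : ℕ :=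
  sInf {b : ℕ | ∀ S : Set (Eqn n), ∀ x : Fin n → ℕ,
    Solves S x → (∀ i, x i ≤ m) →
    (∀ y : Fin n → ℕ, Solves S y → (∀ i, y i ≤ m) → y = x) →
    ∀ i, x i ≤ b}

/-- `y` is a duplicate of `x`. -/
def Duplicate {n : ℕ} (x y : Fin n → ℕ) : Prop :=
  (∀ i, x i = 1 → y i = 1) ∧
  (∀ i j k, x i + x j = x k → y i + y j = y k) ∧
  (∀ i j k, x i * x j = x k → y i * y j = y k)

theorem stmt_14 (n : ℕ) (hn : 0 < n) (m : ℕ) :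
    beta n m = sInf {b : ℕ | ∀ x : Fin n → ℕ, (∀ i, x i ≤ m) →
      (∀ y : Fin n → ℕ, (∀ i, y i ≤ m) → y ≠ x → ¬ Duplicate x y) →
      ∀ i, x i ≤ b} := by
  unfold beta
  congr 1
  ext b
  simp only [Set.mem_setOf_eq]
  constructor
  · intro h x hx hd
    refine h {e | e.Holds x} x (fun e he => he) hx ?_
    intro y hy hym
    by_contra hne
    exact hd y hym hne ⟨fun i hi => hy (.one i) hi, fun i j k hi => hy (.add i j k) hi,
      fun i j k hi => hy (.mul i j k) hi⟩
  · intro h S x hS hx hu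
    refine h x hx ?_
    rintro y hym hne ⟨h1, h2, h3⟩
    refine hne (hu y ?_ hym)
    intro e he
    have hex := hS e he
    cases e with
    | one k => exact h1 k hex
    | add i j k => exact h2 i j k hex
    | mul i j k => exact h3 i j k hex
end

section
/- If there exists a computable function h : ℕ → ℕ such that f(n) ≤ h(n) for every positive integer n, then every set M ⊆ ℕ^k (k ≥ 1) which has a single-fold Diophantine representation is computable (decidable). -/
/-- `f n` is the smallest `b` such that for each system `S ⊆ E_n` with a unique
solution in non-negative integers, this solution belongs to `[0, b]^n`. -/
noncomputable def f (n : ℕ) : ℕ :=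
  sInf {b : ℕ | ∀ S : Set (Eqn n), ∀ x : Fin n → ℕ,
    Solves S x → (∀ y : Fin n → ℕ, Solves S y → y = x) → ∀ i, x i ≤ b}

/-- `M ⊆ ℕ^k` has a single-fold Diophantine representation. -/
def SingleFoldRepSet (k : ℕ) (M : Set (Fin k → ℕ)) : Prop :=
  ∃ (m : ℕ) (W : MvPolynomial (Fin (k + m)) ℤ),
    (∀ a : Fin k → ℕ, a ∈ M ↔ ∃ x : Fin m → ℕ,
      MvPolynomial.eval (Fin.append (fun i => ((a i : ℤ))) (fun i => ((x i : ℤ)))) W = 0) ∧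
    (∀ a : Fin k → ℕ, ∀ x y : Fin m → ℕ,
      MvPolynomial.eval (Fin.append (fun i => ((a i : ℤ))) (fun i => ((x i : ℤ)))) W = 0 →
      MvPolynomial.eval (Fin.append (fun i => ((a i : ℤ))) (fun i => ((y i : ℤ)))) W = 0 →
      x = y)

/-! ### Definable relations -/

/-- A relation on tuples expressible by a set of equations (after any re-indexing). -/
def EDef {ι : Type} (R : (ι → ℕ) → Prop) : Prop :=
  ∀ (n : ℕ) (g : ι → Fin n), ∃ S : Set (Eqn n), ∀ x : Fin n → ℕ, Solves S x ↔ R (x ∘ g)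

theorem EDef.one {ι : Type} (k : ι) : EDef (fun x : ι → ℕ => x k = 1) := fun n g =>
  ⟨{Eqn.one (g k)}, fun x => by simp [Solves, Eqn.Holds]⟩

theorem EDef.add {ι : Type} (i j k : ι) : EDef (fun x : ι → ℕ => x i + x j = x k) := fun n g =>
  ⟨{Eqn.add (g i) (g j) (g k)}, fun x => by simp [Solves, Eqn.Holds]⟩

theorem EDef.mul {ι : Type} (i j k : ι) : EDef (fun x : ι → ℕ => x i * x j = x k) := fun n g =>
  ⟨{Eqn.mul (g i) (g j) (g k)}, fun x => by simp [Solves, Eqn.Holds]⟩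

theorem EDef.and {ι : Type} {R R' : (ι → ℕ) → Prop} (h : EDef R) (h' : EDef R') :
    EDef (fun x => R x ∧ R' x) := fun n g => by
  obtain ⟨S, hS⟩ := h n g
  obtain ⟨S', hS'⟩ := h' n g
  refine ⟨S ∪ S', fun x => ?_⟩
  show _ ↔ R (x ∘ g) ∧ R' (x ∘ g)
  rw [← hS, ← hS']
  simp only [Solves, Set.mem_union]
  constructor
  · exact fun H => ⟨fun e he => H e (Or.inl he), fun e he => H e (Or.inr he)⟩
  · rintro ⟨H1, H2⟩ e (he | he)
    · exact H1 e he
    · exact H2 e he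

theorem EDef.all {ι J : Type} {R : J → (ι → ℕ) → Prop} (h : ∀ j, EDef (R j)) :
    EDef (fun x => ∀ j, R j x) := fun n g => by
  choose S hS using fun j => h j n g
  refine ⟨⋃ j, S j, fun x => ?_⟩
  simp only [← hS, Solves, Set.mem_iUnion]
  constructor
  · exact fun H j e he => H e ⟨j, he⟩
  · rintro H e ⟨j, he⟩
    exact H j e he

theorem EDef.rename {ι κ : Type} {R : (ι → ℕ) → Prop} (h : EDef R) (r : ι → κ) :
    EDef (fun x : κ → ℕ => R (x ∘ r)) := fun n g => h n (g ∘ r)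

theorem EDef.of_iff {ι : Type} {R R' : (ι → ℕ) → Prop} (h : EDef R) (H : ∀ x, R x ↔ R' x) :
    EDef R' := by
  have : R = R' := funext fun x => propext (H x)
  exact this ▸ h

/-! ### The bound -/

theorem eqn_finite (n : ℕ) : Finite (Eqn n) := by
  let φ : Eqn n → Fin n ⊕ (Fin n × Fin n × Fin n) ⊕ (Fin n × Fin n × Fin n) := fun e =>
    match e with
    | .one k => Sum.inl k
    | .add i j k => Sum.inr (Sum.inl (i, j, k))
    | .mul i j k => Sum.inr (Sum.inr (i, j, k))
  refine Finite.of_injective φ ?_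
  rintro (_ | _ | _) (_ | _ | _) h <;> simp_all [φ]

theorem f_spec (n : ℕ) : ∀ S : Set (Eqn n), ∀ x : Fin n → ℕ,
    Solves S x → (∀ y : Fin n → ℕ, Solves S y → y = x) → ∀ i, x i ≤ f n := by
  have hne : {b : ℕ | ∀ S : Set (Eqn n), ∀ x : Fin n → ℕ,
    Solves S x → (∀ y : Fin n → ℕ, Solves S y → y = x) → ∀ i, x i ≤ b}.Nonempty := by
    classical
    have := eqn_finite n
    have : Fintype (Set (Eqn n)) := Fintype.ofFinite _
    have hb : ∀ S : Set (Eqn n), ∃ b : ℕ, ∀ x : Fin n → ℕ,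
        Solves S x → (∀ y : Fin n → ℕ, Solves S y → y = x) → ∀ i, x i ≤ b := by
      intro S
      by_cases hx : ∃ x : Fin n → ℕ, Solves S x
      · obtain ⟨x, hx⟩ := hx
        refine ⟨∑ i, x i, fun x' _ hu i => ?_⟩
        rw [← hu x hx]
        exact Finset.single_le_sum (f := x) (fun _ _ => Nat.zero_le _) (Finset.mem_univ i)
      · exact ⟨0, fun x h => absurd ⟨x, h⟩ hx⟩
    choose b hb using hb
    refine ⟨∑ S, b S, fun S x h1 h2 i => (hb S x h1 h2 i).trans ?_⟩
    exact Finset.single_le_sum (f := b) (fun _ _ => Nat.zero_le _) (Finset.mem_univ S)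
  exact Nat.sInf_mem hne

theorem bound_of_EDef {T : Type} [Fintype T] {R : (T → ℕ) → Prop} (hR : EDef R) (x : T → ℕ)
    (hx : R x) (hu : ∀ y, R y → y = x) (t : T) : x t ≤ f (Fintype.card T) := by
  let e := Fintype.equivFin T
  obtain ⟨S, hS⟩ := hR _ e
  have := f_spec _ S (x ∘ e.symm) ((hS _).2 (by simpa [Function.comp_assoc] using hx))
    (fun y hy => by
      have := hu _ ((hS y).1 hy)
      rw [← this]; simp [Function.comp_assoc]) (e t)
  simpa using this

/-! ### Circuits -/

/-- A circuit computing the polynomial `p`. -/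
def Circ {σ : Type} (p : MvPolynomial σ ℕ) : Prop :=
  ∃ (τ : Type) (_ : Fintype τ) (F : (σ → ℕ) → τ → ℕ) (o : σ ⊕ τ),
    EDef (fun x : σ ⊕ τ → ℕ => x ∘ Sum.inr = F (x ∘ Sum.inl)) ∧
    ∀ x : σ ⊕ τ → ℕ, x ∘ Sum.inr = F (x ∘ Sum.inl) → x o = MvPolynomial.eval (x ∘ Sum.inl) p

theorem Circ.op {σ : Type} {p q r : MvPolynomial σ ℕ} (op : ℕ → ℕ → ℕ)
    (hop : ∀ (ι : Type) (i j k : ι), EDef (fun x : ι → ℕ => op (x i) (x j) = x k))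
    (hr : ∀ v, MvPolynomial.eval v r = op (MvPolynomial.eval v p) (MvPolynomial.eval v q))
    (hp : Circ p) (hq : Circ q) : Circ r := by
  obtain ⟨τ₁, _, F₁, o₁, d₁, h₁⟩ := hp
  obtain ⟨τ₂, _, F₂, o₂, d₂, h₂⟩ := hq
  let r₁ : σ ⊕ τ₁ → σ ⊕ (τ₁ ⊕ τ₂ ⊕ Unit) := Sum.map id Sum.inl
  let r₂ : σ ⊕ τ₂ → σ ⊕ (τ₁ ⊕ τ₂ ⊕ Unit) := Sum.map id (Sum.inr ∘ Sum.inl)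
  let o : σ ⊕ (τ₁ ⊕ τ₂ ⊕ Unit) := Sum.inr (Sum.inr (Sum.inr ()))
  refine ⟨τ₁ ⊕ τ₂ ⊕ Unit, inferInstance,
    fun v => Sum.elim (F₁ v) (Sum.elim (F₂ v) (fun _ => MvPolynomial.eval v r)), o, ?_, ?_⟩
  · refine (((d₁.rename r₁).and (d₂.rename r₂)).and (hop _ (r₁ o₁) (r₂ o₂) o)).of_iff fun x => ?_
    constructor
    · rintro ⟨⟨e₁, e₂⟩, e₃⟩
      have g₁ := h₁ _ e₁
      have g₂ := h₂ _ e₂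
      funext t
      rcases t with t | t | t
      · exact congrFun e₁ t
      · exact congrFun e₂ t
      · have : x o = MvPolynomial.eval (x ∘ Sum.inl) r := by
          rw [hr, ← e₃]
          exact congrArg₂ op g₁ g₂
        exact this
    · intro e
      have e₁ : (x ∘ r₁) ∘ Sum.inr = F₁ ((x ∘ r₁) ∘ Sum.inl) :=
        funext fun t => congrFun e (Sum.inl t)
      have e₂ : (x ∘ r₂) ∘ Sum.inr = F₂ ((x ∘ r₂) ∘ Sum.inl) :=
        funext fun t => congrFun e (Sum.inr (Sum.inl t))
      refine ⟨⟨e₁, e₂⟩, ?_⟩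
      have : x o = MvPolynomial.eval (x ∘ Sum.inl) r := congrFun e (Sum.inr (Sum.inr ()))
      rw [this, hr]
      exact congrArg₂ op (h₁ _ e₁) (h₂ _ e₂)
  · intro x e
    exact congrFun e (Sum.inr (Sum.inr ()))

theorem Circ.add {σ : Type} {p q : MvPolynomial σ ℕ} (hp : Circ p) (hq : Circ q) :
    Circ (p + q) :=
  Circ.op (· + ·) (fun _ => EDef.add) (by simp) hp hq

theorem Circ.mul {σ : Type} {p q : MvPolynomial σ ℕ} (hp : Circ p) (hq : Circ q) :
    Circ (p * q) :=
  Circ.op (· * ·) (fun _ => EDef.mul) (by simp) hp hq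

theorem Circ.zero {σ : Type} : Circ (0 : MvPolynomial σ ℕ) := by
  refine ⟨Unit, inferInstance, fun _ _ => 0, Sum.inr (), ?_, ?_⟩
  · refine (EDef.add (Sum.inr ()) (Sum.inr ()) (Sum.inr ())).of_iff fun x => ?_
    constructor
    · intro hx
      funext t
      simpa using hx
    · intro hx
      simpa using congrFun hx ()
  · intro x e
    simpa using congrFun e ()

theorem Circ.one {σ : Type} : Circ (1 : MvPolynomial σ ℕ) := by
  refine ⟨Unit, inferInstance, fun _ _ => 1, Sum.inr (), ?_, ?_⟩
  · refine (EDef.one (Sum.inr ())).of_iff fun x => ?_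
    constructor
    · intro hx
      funext t
      simpa using hx
    · intro hx
      simpa using congrFun hx ()
  · intro x e
    simpa using congrFun e ()

theorem Circ.X {σ : Type} (i : σ) : Circ (MvPolynomial.X i : MvPolynomial σ ℕ) := by
  refine ⟨Empty, inferInstance, fun _ => Empty.elim, Sum.inl i, ?_, ?_⟩
  · refine (EDef.all (J := Empty) (R := fun _ _ => True) (fun j => j.elim)).of_iff fun x => ?_
    simp [funext_iff]
  · intro x e
    simp

theorem circ_all {σ : Type} (p : MvPolynomial σ ℕ) : Circ p := by
  induction p using MvPolynomial.induction_on with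
  | C a =>
    induction a with
    | zero => simpa using Circ.zero
    | succ a ih => simpa using ih.add Circ.one
  | add p q hp hq => exact hp.add hq
  | mul_X p i hp => exact hp.mul (Circ.X i)

theorem circ_eq {σ : Type} (p q : MvPolynomial σ ℕ) :
    ∃ (τ : Type) (_ : Fintype τ) (F : (σ → ℕ) → τ → ℕ),
      EDef (fun x : σ ⊕ τ → ℕ => x ∘ Sum.inr = F (x ∘ Sum.inl) ∧
        MvPolynomial.eval (x ∘ Sum.inl) p = MvPolynomial.eval (x ∘ Sum.inl) q) := by
  obtain ⟨τ₁, _, F₁, o₁, d₁, h₁⟩ := circ_all p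
  obtain ⟨τ₂, _, F₂, o₂, d₂, h₂⟩ := circ_all q
  let r₁ : σ ⊕ τ₁ → σ ⊕ (τ₁ ⊕ τ₂ ⊕ Unit) := Sum.map id Sum.inl
  let r₂ : σ ⊕ τ₂ → σ ⊕ (τ₁ ⊕ τ₂ ⊕ Unit) := Sum.map id (Sum.inr ∘ Sum.inl)
  let o : σ ⊕ (τ₁ ⊕ τ₂ ⊕ Unit) := Sum.inr (Sum.inr (Sum.inr ()))
  refine ⟨τ₁ ⊕ τ₂ ⊕ Unit, inferInstance,
    fun v => Sum.elim (F₁ v) (Sum.elim (F₂ v) (fun _ => 0)), ?_⟩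
  refine (((d₁.rename r₁).and (d₂.rename r₂)).and
    ((EDef.add o o o).and (EDef.add (r₁ o₁) o (r₂ o₂)))).of_iff fun x => ?_
  constructor
  · rintro ⟨⟨e₁, e₂⟩, e₃, e₄⟩
    have g₁ : x (r₁ o₁) = MvPolynomial.eval (x ∘ Sum.inl) p := h₁ _ e₁
    have g₂ : x (r₂ o₂) = MvPolynomial.eval (x ∘ Sum.inl) q := h₂ _ e₂
    have z : x o = 0 := by omega
    refine ⟨?_, by omega⟩
    funext t
    rcases t with t | t | t
    · exact congrFun e₁ t
    · exact congrFun e₂ t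
    · exact z
  · rintro ⟨e, e'⟩
    have e₁ : (x ∘ r₁) ∘ Sum.inr = F₁ ((x ∘ r₁) ∘ Sum.inl) :=
      funext fun t => congrFun e (Sum.inl t)
    have e₂ : (x ∘ r₂) ∘ Sum.inr = F₂ ((x ∘ r₂) ∘ Sum.inl) :=
      funext fun t => congrFun e (Sum.inr (Sum.inl t))
    have g₁ : x (r₁ o₁) = MvPolynomial.eval (x ∘ Sum.inl) p := h₁ _ e₁
    have g₂ : x (r₂ o₂) = MvPolynomial.eval (x ∘ Sum.inl) q := h₂ _ e₂
    have z : x o = 0 := congrFun e (Sum.inr (Sum.inr ()))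
    exact ⟨⟨e₁, e₂⟩, by omega, by omega⟩

/-! ### Splitting an integer polynomial -/

theorem split_poly {σ : Type} (W : MvPolynomial σ ℤ) :
    ∃ p q : MvPolynomial σ ℕ, ∀ v : σ → ℕ,
      MvPolynomial.eval (fun i => (v i : ℤ)) W
        = (MvPolynomial.eval v p : ℤ) - (MvPolynomial.eval v q : ℤ) := by
  induction W using MvPolynomial.induction_on with
  | C a =>
    refine ⟨MvPolynomial.C a.toNat, MvPolynomial.C (-a).toNat, fun v => ?_⟩
    simp only [MvPolynomial.eval_C]
    omega
  | add W W' h h' =>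
    obtain ⟨p, q, h⟩ := h
    obtain ⟨p', q', h'⟩ := h'
    refine ⟨p + p', q + q', fun v => ?_⟩
    simp only [map_add, h, h']
    push_cast
    ring
  | mul_X W i h =>
    obtain ⟨p, q, h⟩ := h
    refine ⟨p * MvPolynomial.X i, q * MvPolynomial.X i, fun v => ?_⟩
    simp only [map_mul, h, MvPolynomial.eval_X]
    push_cast
    ring

/-! ### The effective bound on the solution -/

theorem solution_bound (k m : ℕ) (p q : MvPolynomial (Fin (k + m)) ℕ)
    (huniq : ∀ (a : Fin k → ℕ) (x y : Fin m → ℕ),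
      MvPolynomial.eval (Fin.append a x) p = MvPolynomial.eval (Fin.append a x) q →
      MvPolynomial.eval (Fin.append a y) p = MvPolynomial.eval (Fin.append a y) q → x = y) :
    ∃ C : ℕ, ∀ (a : Fin k → ℕ) (x : Fin m → ℕ),
      MvPolynomial.eval (Fin.append a x) p = MvPolynomial.eval (Fin.append a x) q →
      ∀ i, x i ≤ f ((∑ i, a i) + (C + 1)) := by
  obtain ⟨τ, _, F, hF⟩ := circ_eq p q
  refine ⟨m + 1 + Fintype.card τ, fun a x hx i => ?_⟩
  set N := ∑ i, a i with hN
  have ha : ∀ i, a i < N + 1 := fun i => Nat.lt_succ_of_le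
    (Finset.single_le_sum (f := a) (fun _ _ => Nat.zero_le _) (Finset.mem_univ i))
  let T := (Fin m ⊕ τ) ⊕ (Fin (N + 1) ⊕ Unit)
  let ch : Fin (N + 1) → T := fun j => Sum.inr (Sum.inl j)
  let u : T := Sum.inr (Sum.inr ())
  let xv : Fin m → T := fun j => Sum.inl (Sum.inl j)
  let r : Fin (k + m) ⊕ τ → T :=
    Sum.elim (Fin.append (fun i => ch ⟨a i, ha i⟩) xv) (fun t => Sum.inl (Sum.inr t))
  have hch : EDef (fun z : T → ℕ => (∀ j : Fin N, z (ch j.castSucc) + z u = z (ch j.succ))) :=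
    EDef.all fun j => EDef.add _ _ _
  have hdef := (((EDef.one u).and (EDef.add (ch 0) (ch 0) (ch 0))).and hch).and (hF.rename r)
  have hchain : ∀ z : T → ℕ, (z u = 1 ∧ z (ch 0) + z (ch 0) = z (ch 0)) ∧
      (∀ j : Fin N, z (ch j.castSucc) + z u = z (ch j.succ)) → ∀ j, z (ch j) = j.val := by
    rintro z ⟨⟨h1, h0⟩, hs⟩ j
    induction j using Fin.induction with
    | zero => simp only [Fin.val_zero]; omega
    | succ j ih => rw [← hs, ih, h1]; simp
  have happ : ∀ z : T → ℕ, (∀ j, z (ch j) = j.val) →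
      (z ∘ r) ∘ Sum.inl = Fin.append a (z ∘ xv) := by
    intro z hz
    funext j
    refine Fin.addCases (fun j => ?_) (fun j => ?_) j
    · simp [r, hz]
    · simp [r]
  let z : T → ℕ := Sum.elim (Sum.elim x (F (Fin.append a x))) (Sum.elim (fun j => j.val) fun _ => 1)
  have hz : ∀ j, z (ch j) = j.val := fun j => rfl
  have hzx : z ∘ xv = x := rfl
  have := bound_of_EDef hdef z ?_ ?_ (xv i)
  · have hc : Fintype.card T = N + (m + 1 + Fintype.card τ + 1) := by
      simp [T]; ring
    rw [hc] at this
    exact this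
  · refine ⟨⟨⟨rfl, rfl⟩, fun j => ?_⟩, ?_, ?_⟩
    · simp [z, ch, u]
    · rw [happ z hz, hzx]; rfl
    · rw [happ z hz, hzx]; exact hx
  · rintro y ⟨hc, hy1, hy2⟩
    have hy := hchain y hc
    rw [happ y hy] at hy1 hy2
    have hxy : y ∘ xv = x := huniq a _ _ hy2 hx
    rw [hxy] at hy1
    funext t
    rcases t with (t | t) | (t | t)
    · exact congrFun hxy t
    · exact congrFun hy1 t
    · exact hy t
    · exact hc.1.1

/-! ### Computability -/

theorem primrec_eval {n : ℕ} (p : MvPolynomial (Fin n) ℕ) :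
    Primrec (fun v : Fin n → ℕ => MvPolynomial.eval v p) := by
  induction p using MvPolynomial.induction_on with
  | C a => simpa using Primrec.const a
  | add p q hp hq => simpa using Primrec.nat_add.comp hp hq
  | mul_X p i hp =>
    have : Primrec (fun v : Fin n → ℕ => v i) := Primrec.fin_app.comp Primrec.id (Primrec.const i)
    simpa using Primrec.nat_mul.comp hp this

theorem primrec_app {n : ℕ} (i : Fin n) : Primrec (fun v : Fin n → ℕ => v i) :=
  Primrec.fin_app.comp Primrec.id (Primrec.const i)

theorem primrec_tuple {α : Type} [Primcodable α] {n : ℕ} {g : α → Fin n → ℕ}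
    (h : ∀ i, Primrec fun a => g a i) : Primrec g := by
  rw [Primrec.fin_curry]
  have : Primrec₂ (fun i a => g a i) := Primrec.fin_curry₁.2 h
  exact this.swap

theorem primrec_bounded_exists (m : ℕ) : ∀ {α : Type} [Primcodable α]
    (Q : α × (Fin m → ℕ) → Prop) (_ : PrimrecPred Q) (b : α → ℕ) (_ : Primrec b),
    PrimrecPred (fun a => ∃ x : Fin m → ℕ, (∀ i, x i ≤ b a) ∧ Q (a, x)) := by
  induction m with
  | zero =>
    intro α _ Q hQ b hb
    refine (hQ.comp (Primrec.pair Primrec.id (Primrec.const Fin.elim0))).of_eq fun a => ?_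
    constructor
    · exact fun h => ⟨_, fun i => i.elim0, h⟩
    · rintro ⟨x, -, h⟩
      rwa [Subsingleton.elim x Fin.elim0] at h
  | succ m ih =>
    intro α _ Q hQ b hb
    have h1 : Primrec (fun s : (ℕ × α) × (Fin m → ℕ) =>
        ((s.1.2, (Fin.cons s.1.1 s.2 : Fin (m + 1) → ℕ)) : α × (Fin (m + 1) → ℕ))) := by
      refine Primrec.pair (Primrec.snd.comp Primrec.fst) (primrec_tuple fun i => ?_)
      refine Fin.cases ?_ (fun j => ?_) i
      · simpa using Primrec.fst.comp Primrec.fst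
      · simpa using (primrec_app j).comp Primrec.snd
    have h2 := ih _ (hQ.comp h1) (fun s : ℕ × α => b s.2) (hb.comp Primrec.snd)
    have h2' : PrimrecRel (fun (x0 : ℕ) (a : α) => ∃ x : Fin m → ℕ, (∀ i, x i ≤ b a) ∧
        Q (a, (Fin.cons x0 x : Fin (m + 1) → ℕ))) := h2
    have h3 : PrimrecPred (fun a : α => ∃ x0 < (b a).succ, ∃ x : Fin m → ℕ, (∀ i, x i ≤ b a) ∧
        Q (a, (Fin.cons x0 x : Fin (m + 1) → ℕ))) :=
      ((PrimrecRel.exists_mem_list h2').comp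
        (Primrec.list_range.comp (Primrec.succ.comp hb)) Primrec.id).of_eq (by simp)
    refine h3.of_eq fun a => ?_
    constructor
    · rintro ⟨x0, hx0, x, hx, h⟩
      refine ⟨Fin.cons x0 x, fun i => ?_, h⟩
      refine Fin.cases ?_ (fun j => ?_) i
      · simpa using Nat.lt_succ_iff.1 hx0
      · simpa using hx j
    · rintro ⟨x, hx, h⟩
      refine ⟨x 0, Nat.lt_succ_of_le (hx 0), Fin.tail x, fun i => hx _, ?_⟩
      simpa using h

theorem stmt_15 (h : ℕ → ℕ) (hcomp : Computable h)
    (hmaj : ∀ n : ℕ, 0 < n → f n ≤ h n) :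
    ∀ k : ℕ, 0 < k → ∀ M : Set (Fin k → ℕ), SingleFoldRepSet k M →
      ComputablePred (fun a : Fin k → ℕ => a ∈ M) := by
  rintro k - M ⟨m, W, hM, hu⟩
  obtain ⟨p, q, hpq⟩ := split_poly W
  have key : ∀ (a : Fin k → ℕ) (x : Fin m → ℕ),
      MvPolynomial.eval (Fin.append (fun i => ((a i : ℤ))) (fun i => ((x i : ℤ)))) W = 0 ↔
      MvPolynomial.eval (Fin.append a x) p = MvPolynomial.eval (Fin.append a x) q := by
    intro a x
    have e : (Fin.append (fun i => ((a i : ℤ))) (fun i => ((x i : ℤ))))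
        = fun i => ((Fin.append a x i : ℕ) : ℤ) := by
      funext j
      refine Fin.addCases (fun j => ?_) (fun j => ?_) j <;> simp
    rw [e, hpq, sub_eq_zero, Nat.cast_inj]
  simp only [key] at hM hu
  obtain ⟨C, hC⟩ := solution_bound k m p q hu
  have hQ : PrimrecPred (fun s : ((Fin k → ℕ) × ℕ) × (Fin m → ℕ) =>
      MvPolynomial.eval (Fin.append s.1.1 s.2) p = MvPolynomial.eval (Fin.append s.1.1 s.2) q) := by
    have ht : Primrec (fun s : ((Fin k → ℕ) × ℕ) × (Fin m → ℕ) =>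
        (Fin.append s.1.1 s.2 : Fin (k + m) → ℕ)) := by
      refine primrec_tuple fun i => ?_
      refine Fin.addCases (fun j => ?_) (fun j => ?_) i
      · simpa using (primrec_app j).comp (Primrec.fst.comp Primrec.fst)
      · simpa using (primrec_app j).comp Primrec.snd
    exact Primrec.eq.comp ((primrec_eval p).comp ht) ((primrec_eval q).comp ht)
  have hE := primrec_bounded_exists m _ hQ (fun s => s.2) Primrec.snd
  have hs : Primrec (fun a : Fin k → ℕ => (∑ i, a i) + (C + 1)) := by
    refine (primrec_eval ((∑ i, MvPolynomial.X i) + MvPolynomial.C (C + 1))).of_eq fun a => ?_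
    rw [map_add, map_sum, MvPolynomial.eval_C]
    simp only [MvPolynomial.eval_X]
  have hb : Computable (fun a : Fin k → ℕ => (a, h ((∑ i, a i) + (C + 1)))) :=
    Computable.pair Computable.id (hcomp.comp hs.to_comp)
  obtain ⟨_, hE⟩ := hE
  have hfin := (hE.to_comp.comp hb).computablePred
  refine hfin.of_eq fun a => ?_
  rw [hM]
  constructor
  · rintro ⟨x, -, hx⟩
    exact ⟨x, hx⟩
  · rintro ⟨x, hx⟩
    exact ⟨x, fun i => (hC a x hx i).trans (hmaj _ (by omega)), hx⟩
end

section
/- The function f_{ω₁} is not computable; indeed, there is no computable function h : ℕ → ℕ such that f_{ω₁}(n) ≤ h(n) for every positive integer n. -/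
/-- `fOmega1 n` is the smallest `b` such that for each system `S ⊆ E_n` which has a
solution in non-negative integers, some solution has all coordinates `≤ b`. -/
noncomputable def fOmega1 (n : ℕ) : ℕ :=
  sInf {b : ℕ | ∀ S : Set (Eqn n),
    (∃ x : Fin n → ℕ, Solves S x) →
    ∃ x : Fin n → ℕ, Solves S x ∧ ∀ i, x i ≤ b}



namespace H10
open Nat

theorem digits_lt (d : ℕ → ℕ) (u : ℕ) (hd : ∀ i, d i < u) (k : ℕ) :
    ∑ i ∈ Finset.range k, d i * u ^ i < u ^ k := by
  induction k with
  | zero => simp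
  | succ k ih =>
    rw [Finset.sum_range_succ, pow_succ]
    have h1 : (d k + 1) * u ^ k ≤ u * u ^ k := Nat.mul_le_mul_right _ (hd k)
    nlinarith

theorem digit_eq (d : ℕ → ℕ) (u : ℕ) (hd : ∀ i, d i < u) (k m : ℕ) :
    ((∑ i ∈ Finset.range (k + 1 + m), d i * u ^ i) / u ^ k) % u = d k := by
  have hu : 0 < u := lt_of_le_of_lt (Nat.zero_le _) (hd 0)
  have h : ∑ i ∈ Finset.range (k + 1 + m), d i * u ^ i =
      (∑ i ∈ Finset.range k, d i * u ^ i) +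
        u ^ k * (d k + u * ∑ i ∈ Finset.range m, d (k + 1 + i) * u ^ i) := by
    rw [Finset.sum_range_add, Finset.sum_range_succ]
    have : ∑ x ∈ Finset.range m, d (k + 1 + x) * u ^ (k + 1 + x) =
      u ^ k * u * ∑ i ∈ Finset.range m, d (k + 1 + i) * u ^ i := by
      rw [Finset.mul_sum]; refine Finset.sum_congr rfl fun i _ => ?_
      ring
    rw [this]; ring
  rw [h, Nat.add_mul_div_left _ _ (pow_pos hu k), Nat.div_eq_of_lt (digits_lt d u hd k), zero_add,
    Nat.add_mul_mod_self_left, Nat.mod_eq_of_lt (hd k)]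

theorem choose_eq_pow (n k : ℕ) :
    n.choose k = ((2 ^ n + 2) ^ n / (2 ^ n + 1) ^ k) % (2 ^ n + 1) := by
  have hd : ∀ i, n.choose i < 2 ^ n + 1 := fun i => Nat.lt_succ_of_le (Nat.choose_le_two_pow n i)
  rw [← digit_eq (fun i => n.choose i) (2 ^ n + 1) hd k n]
  congr 2
  have h2 : (2 ^ n + 2) ^ n = ∑ i ∈ Finset.range (n + 1), n.choose i * (2 ^ n + 1) ^ i := by
    rw [show 2 ^ n + 2 = (2 ^ n + 1) + 1 from rfl, add_pow]
    refine Finset.sum_congr rfl fun i _ => ?_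
    simp [mul_comm]
  rw [h2, show k + 1 + n = n + 1 + k by ring, Finset.sum_range_add _ (n+1) k]
  rw [Finset.sum_eq_zero (s := Finset.range k), add_zero]
  intro i _
  rw [Nat.choose_eq_zero_of_lt (by omega), zero_mul]

theorem pow_le_descFactorial (r n : ℕ) (h : n ≤ r) :
    r * r ^ n ≤ r * r.descFactorial n + n ^ 2 * r ^ n := by
  induction n with
  | zero => simp
  | succ n ih =>
    have ih := ih (by omega)
    obtain ⟨e, rfl⟩ : ∃ e, r = n + 1 + e := ⟨r - (n + 1), by omega⟩
    set r := n + 1 + e with hr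
    rw [Nat.descFactorial_succ]
    have hD : r.descFactorial n ≤ r ^ n := Nat.descFactorial_le_pow r n
    have h1 : r - n = e + 1 := by omega
    rw [h1]
    set D := r.descFactorial n
    have e1 : r * D * r = r * ((e + 1) * D) + n * (r * D) := by rw [hr]; ring
    have e2 : n * (r * D) ≤ n * (r * r ^ n) := by gcongr
    have e3 : r * r ^ n * r ≤ (r * D + n ^ 2 * r ^ n) * r := by gcongr
    have e4 : 0 ≤ (n+1) * (r * r ^ n) := by positivity
    rw [pow_succ r n]
    nlinarith

theorem factorial_eq_div (n : ℕ) :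
    n ! = (n ^ 2 * (n ^ n + 1) + 1 + n) ^ n / (n ^ 2 * (n ^ n + 1) + 1 + n).choose n := by
  set r := n ^ 2 * (n ^ n + 1) + 1 + n with hr
  have hnr : n ≤ r := by omega
  have hC : 0 < r.choose n := Nat.choose_pos hnr
  have hD : r.descFactorial n = n ! * r.choose n := Nat.descFactorial_eq_factorial_mul_choose r n
  have h1 := pow_le_descFactorial r n hnr
  have hF : n ! ≤ n ^ n := Nat.factorial_le_pow n
  have hle := Nat.descFactorial_le_pow r n
  have hF0 : 0 < n ! := Nat.factorial_pos n
  symm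
  rw [Nat.div_eq_iff hC]
  refine ⟨by rw [← hD]; exact hle, ?_⟩
  suffices h : r ^ n < (n ! + 1) * r.choose n by
    rw [add_mul, one_mul] at h; omega
  by_contra hcon
  push Not at hcon
  have hr0 : 0 < r ^ n := by positivity
  -- r * r^n ≤ r * D + n^2 r^n ; D + C ≤ r^n
  have h2 : r * (r.descFactorial n + r.choose n) ≤ r * r ^ n := by
    gcongr; rw [hD]; linarith
  have h3 : r * r.choose n ≤ n ^ 2 * r ^ n := by nlinarith
  -- multiply by n!: r * D ≤ n! n^2 r^n
  have h4 : r * r.descFactorial n ≤ n ! * (n ^ 2 * r ^ n) := by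
    rw [hD]
    calc r * (n ! * r.choose n) = n ! * (r * r.choose n) := by ring
      _ ≤ _ := by gcongr
  have h5 : r * r ^ n ≤ (n ! * n ^ 2 + n ^ 2) * r ^ n := by nlinarith
  have h6 : r ≤ n ! * n ^ 2 + n ^ 2 := Nat.le_of_mul_le_mul_right h5 hr0
  have h7 : n ! * n ^ 2 ≤ n ^ n * n ^ 2 := by gcongr
  have : r = n ^ n * n ^ 2 + n ^ 2 + 1 + n := by rw [hr]; ring
  omega

/-! moduli -/

theorem choose_eq_prod (s n : ℕ) (h : ∀ k < n, (k + 1) ∣ s) :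
    (s - 1).choose n = ∏ k ∈ Finset.range n, (s / (k + 1) - 1) := by
  induction n with
  | zero => simp
  | succ n ih =>
    rw [Finset.prod_range_succ, ← ih fun k hk => h k (by omega)]
    have h1 := Nat.choose_succ_right_eq (s - 1) n
    obtain ⟨a, ha⟩ := h n (by omega)
    have h2 : s - 1 - n = (n + 1) * (a - 1) := by
      rw [Nat.mul_sub, ← ha]; omega
    have h3 : s / (n + 1) = a := by rw [ha]; exact Nat.mul_div_cancel_left _ (by omega)
    rw [h3]
    apply Nat.eq_of_mul_eq_mul_right (show 0 < n + 1 by omega)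
    rw [h1, h2]; ring

theorem moduli (U n : ℕ) (hn : n ≤ U) (hU : 3 ≤ U) :
    ∃ m : ℕ → ℕ, ((U !) * (U !) - 1).choose n = ∏ k ∈ Finset.range n, m k ∧
      (∀ k < n, (U !) * (U !) - 1 ≡ k [MOD m k]) ∧
      (∀ k < n, 1 < m k) ∧ (∀ k < n, ∀ p, p.Prime → p ∣ m k → U < p) ∧
      (∀ k < n, ∀ l < n, k ≠ l → Nat.Coprime (m k) (m l)) := by
  set s := U ! * U ! with hs
  have hF : U ≤ U ! := Nat.self_le_factorial U
  have hdF : ∀ k < n, (k + 1) ∣ U ! := fun k hk => Nat.dvd_factorial (by omega) (by omega)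
  have key : ∀ k < n, (k + 1) * (s / (k + 1) - 1) + (k + 1) = s ∧ U ! ∣ (s / (k + 1) - 1) + 1 ∧
      1 < s / (k + 1) - 1 := by
    intro k hk
    obtain ⟨a, ha⟩ := hdF k hk
    have h3 : s / (k + 1) = U ! * a := by
      rw [hs]; nth_rewrite 1 [ha]; rw [mul_assoc, Nat.mul_div_cancel_left _ (by omega), mul_comm]
    have ha0 : 0 < a := by
      rcases Nat.eq_zero_or_pos a with h | h
      · subst h; omega
      · exact h
    have h4 : U ! ≤ U ! * a := Nat.le_mul_of_pos_right _ ha0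
    rw [h3]
    refine ⟨?_, ?_, by omega⟩
    · have : (k + 1) * (U ! * a - 1 + 1) = s := by
        rw [Nat.sub_add_cancel (by omega), hs]; nth_rewrite 2 [ha]; ring
      rw [← this]; ring
    · rw [Nat.sub_add_cancel (by omega)]; exact dvd_mul_right _ _
  have hp : ∀ k < n, ∀ p, p.Prime → p ∣ (s / (k + 1) - 1) → U < p := by
    intro k hk p pp hd
    by_contra hle
    have h1 : p ∣ U ! := Nat.dvd_factorial pp.pos (by omega)
    have h2 := h1.trans (key k hk).2.1
    have h3 := (Nat.dvd_add_right hd).1 h2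
    exact pp.one_lt.ne' (Nat.dvd_one.1 h3)
  refine ⟨fun k => s / (k + 1) - 1, choose_eq_prod s n fun k hk => (hdF k hk).mul_right _, ?_,
    fun k hk => (key k hk).2.2, hp, ?_⟩
  · intro k hk
    have h := (key k hk).1
    have : s - 1 = k + (s / (k + 1) - 1) * (k + 1) := by rw [mul_comm]; omega
    rw [this]
    simp [Nat.ModEq]
  · have aux : ∀ k < n, ∀ l < n, k < l → Nat.Coprime (s / (k + 1) - 1) (s / (l + 1) - 1) := by
      intro k hk l hl hkl
      refine Nat.coprime_of_dvd fun p pp h1 h2 => ?_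
      have e1 := (key k hk).1
      have e2 := (key l hl).1
      have h3 : p ∣ l - k := by
        have : (k + 1) * (s / (k + 1) - 1) = (l + 1) * (s / (l + 1) - 1) + (l - k) := by omega
        exact (Nat.dvd_add_right (h2.mul_left _)).1 (this ▸ h1.mul_left _)
      have := Nat.le_of_dvd (by omega) h3
      have := hp k hk p pp h1
      omega
    intro k hk l hl hkl
    rcases lt_or_gt_of_ne hkl with h | h
    · exact aux k hk l hl h
    · exact (aux l hl k hk h).symm

theorem prod_dvd_iff (n : ℕ) (m : ℕ → ℕ)
    (hc : ∀ k < n, ∀ l < n, k ≠ l → Nat.Coprime (m k) (m l)) (N : ℕ) 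
    (h : ∀ k < n, m k ∣ N) : ∏ k ∈ Finset.range n, m k ∣ N := by
  refine Finset.prod_dvd_of_isRelPrime ?_ fun k hk => h k (Finset.mem_range.1 hk)
  intro k hk l hl hkl
  exact (Nat.coprime_iff_isRelPrime).1 (hc k (by simpa using hk) l (by simpa using hl) hkl)

end H10


namespace H10
open Nat Dioph

theorem choose_dioph {α : Type} {f g : (α → ℕ) → ℕ} (df : DiophFn f) (dg : DiophFn g) :
    DiophFn fun v => (f v).choose (g v) := by
  have h2 := pow_dioph (const_dioph (α := α) 2) df
  have := mod_dioph (div_dioph (pow_dioph (add_dioph h2 (const_dioph 2)) df)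
    (pow_dioph (add_dioph h2 (const_dioph 1)) dg)) (add_dioph h2 (const_dioph 1))
  have e : (fun v => (f v).choose (g v)) =
    fun v => ((2 ^ f v + 2) ^ f v / (2 ^ f v + 1) ^ g v) % (2 ^ f v + 1) :=
      funext fun v => choose_eq_pow _ _
  rw [e]
  exact this

theorem factorial_dioph {α : Type} {f : (α → ℕ) → ℕ} (df : DiophFn f) :
    DiophFn fun v => (f v)! := by
  have hr := add_dioph (add_dioph (mul_dioph (pow_dioph df (const_dioph (α := α) 2))
    (add_dioph (pow_dioph df df) (const_dioph 1))) (const_dioph 1)) df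
  have := div_dioph (pow_dioph hr df) (choose_dioph hr df)
  have e := fun v => factorial_eq_div (f v)
  simp_rw [e]
  exact this

theorem univ_dioph {α : Type} : Dioph (Set.univ : Set (α → ℕ)) :=
  of_no_dummies _ 0 (by simp)

theorem finset_dioph {α : Type} {ι : Type*} (L : Finset ι) (S : ι → Set (α → ℕ))
    (h : ∀ i ∈ L, Dioph (S i)) : Dioph {v | ∀ i ∈ L, v ∈ S i} := by
  classical
  induction L using Finset.induction_on with
  | empty => exact univ_dioph.ext (by simp)
  | insert a s ha ih =>
    refine ((h a (by simp)).inter (ih fun i hi => h i (by simp [hi]))).ext fun v => ?_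
    simp

theorem all_dioph {α : Type} {ι : Type*} [Fintype ι] (S : ι → Set (α → ℕ))
    (h : ∀ i, Dioph (S i)) : Dioph {v | ∀ i, v ∈ S i} :=
  (finset_dioph Finset.univ S fun i _ => h i).ext (by simp)

theorem ex1 {α : Type} {P : ℕ → (α → ℕ) → Prop}
    (h : Dioph {w : Option α → ℕ | P (w none) (w ∘ some)}) : Dioph {v : α → ℕ | ∃ x, P x v} :=
  (ex1_dioph h).ext fun _ => Iff.rfl

theorem exf {α β : Type} {P : (β → ℕ) → (α → ℕ) → Prop}
    (h : Dioph {w : α ⊕ β → ℕ | P (w ∘ Sum.inr) (w ∘ Sum.inl)}) : 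
    Dioph {v : α → ℕ | ∃ x, P x v} :=
  (ex_dioph h).ext fun _ => Iff.rfl

/-- substitution of Diophantine functions in a Diophantine set -/
theorem subst_dioph {α γ : Type} [Fintype γ] {S : Set (γ → ℕ)} (d : Dioph S)
    (ψ : γ → (α → ℕ) → ℕ) (h : ∀ i, DiophFn (ψ i)) : Dioph {v | (fun i => ψ i v) ∈ S} := by
  have : Dioph {v : α → ℕ | ∃ w : γ → ℕ, (∀ i, w i = ψ i v) ∧ w ∈ S} := by
    apply exf (P := fun w v => (∀ i, w i = ψ i v) ∧ w ∈ S)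
    refine Dioph.inter (all_dioph (fun i => {w : α ⊕ γ → ℕ | w (Sum.inr i) = ψ i (w ∘ Sum.inl)})
      fun i => ?_) (reindex_dioph _ Sum.inr d)
    exact eq_dioph (proj_dioph _) (reindex_diophFn _ (h i))
  refine this.ext fun v => ⟨?_, fun h => ⟨_, fun i => rfl, h⟩⟩
  rintro ⟨w, hw, hS⟩
  rwa [show w = fun i => ψ i v from funext hw] at hS

theorem poly_bound {γ : Type*} {f : (γ → ℕ) → ℤ} (hf : IsPoly f) :
    ∃ (L : Finset γ) (c d : ℕ), ∀ (z : γ → ℕ) (u : ℕ), (∀ i ∈ L, z i ≤ u) →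
      (f z).natAbs ≤ c * (u + 1) ^ d := by
  classical
  induction hf with
  | proj i => 
    refine ⟨{i}, 1, 1, fun z u h => ?_⟩
    have := h i (by simp)
    simp; omega
  | const n => exact ⟨∅, n.natAbs, 0, fun z u h => by simp⟩
  | @sub f g _ _ ihf ihg =>
    obtain ⟨L, c, d, h⟩ := ihf
    obtain ⟨L', c', d', h'⟩ := ihg
    refine ⟨L ∪ L', c + c', d + d', fun z u hz => ?_⟩
    have h1 := h z u fun i hi => hz i (by simp [hi])
    have h2 := h' z u fun i hi => hz i (by simp [hi])
    have h3 := Int.natAbs_sub_le (f z) (g z)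
    have h4 : (u + 1) ^ d ≤ (u + 1) ^ (d + d') := Nat.pow_le_pow_right (by omega) (by omega)
    have h5 : (u + 1) ^ d' ≤ (u + 1) ^ (d + d') := Nat.pow_le_pow_right (by omega) (by omega)
    have h6 := Nat.mul_le_mul_left c h4
    have h7 := Nat.mul_le_mul_left c' h5
    rw [add_mul]; change (f z - g z).natAbs ≤ _; omega
  | @mul f g _ _ ihf ihg =>
    obtain ⟨L, c, d, h⟩ := ihf
    obtain ⟨L', c', d', h'⟩ := ihg
    refine ⟨L ∪ L', c * c', d + d', fun z u hz => ?_⟩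
    have h1 := h z u fun i hi => hz i (by simp [hi])
    have h2 := h' z u fun i hi => hz i (by simp [hi])
    rw [Int.natAbs_mul]
    calc _ ≤ (c * (u + 1) ^ d) * (c' * (u + 1) ^ d') := Nat.mul_le_mul h1 h2
      _ = _ := by ring

theorem poly_modEq {γ : Type*} {f : (γ → ℕ) → ℤ} (hf : IsPoly f) (m : ℕ) (x y : γ → ℕ)
    (h : ∀ i, x i ≡ y i [MOD m]) : f x ≡ f y [ZMOD m] := by
  induction hf with
  | proj i => exact (Int.natCast_modEq_iff).2 (h i)
  | const n => rfl
  | sub _ _ ihf ihg => exact ihf.sub ihg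
  | mul _ _ ihf ihg => exact ihf.mul ihg

theorem dvd_choose_bound {p X u : ℕ} (pp : p.Prime) (h : p ∣ X.choose (u + 1)) : X % p ≤ u := by
  have h1 : p ∣ X.descFactorial (u + 1) := by
    rw [Nat.descFactorial_eq_factorial_mul_choose]; exact h.mul_left _
  rw [Nat.descFactorial_eq_prod_range, pp.prime.dvd_finsetProd_iff] at h1
  obtain ⟨j, hj, hd⟩ := h1
  have hj := Finset.mem_range.1 hj
  rcases le_total X j with h | h
  · exact (Nat.mod_le _ _).trans (by omega)
  · obtain ⟨e, he⟩ := hd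
    have : X = j + p * e := by omega
    rw [this, Nat.add_mul_mod_self_left]
    exact (Nat.mod_le _ _).trans (by omega)

theorem dvd_choose_of_modEq {m X u z : ℕ} (hz : z ≤ u) (h : X ≡ z [MOD m])
    (hp : ∀ p, p.Prime → p ∣ m → u + 1 < p) : m ∣ X.choose (u + 1) := by
  have hc : Nat.Coprime m (u + 1)! := by
    refine Nat.coprime_of_dvd fun p pp h1 h2 => ?_
    have := (pp.dvd_factorial).1 h2
    have := hp p pp h1
    omega
  refine hc.dvd_of_dvd_mul_left ?_
  rw [← Nat.descFactorial_eq_factorial_mul_choose]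
  rcases Nat.lt_or_ge X (u + 1) with h1 | h1
  · rw [Nat.descFactorial_eq_zero_iff_lt.2 h1]; exact dvd_zero _
  · rw [Nat.descFactorial_eq_prod_range]
    refine Dvd.dvd.trans ?_ (Finset.dvd_prod_of_mem _ (Finset.mem_range.2 (show z < u + 1 by omega)))
    exact (Nat.modEq_iff_dvd' (by omega)).1 h.symm

theorem crt (n : ℕ) (m : ℕ → ℕ) (hm : ∀ k < n, 1 < m k)
    (hc : ∀ k < n, ∀ l < n, k ≠ l → Nat.Coprime (m k) (m l)) (a : ℕ → ℕ) :
    ∃ X, ∀ k < n, X ≡ a k [MOD m k] := by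
  obtain ⟨X, hX⟩ := Nat.chineseRemainderOfFinset a m (Finset.range n)
    (fun i hi => by have := hm i (Finset.mem_range.1 hi); omega)
    (fun k hk l hl hkl => hc k (by simpa using hk) l (by simpa using hl) hkl)
  exact ⟨X, fun k hk => hX k (Finset.mem_range.2 hk)⟩

end H10


namespace H10
open Nat Dioph

/-- Side condition on the variables of the polynomial in the bounded quantifier theorem. -/
def Cond {α β : Type} (M u : ℕ) (v : α → ℕ) (X : β → ℕ) : Option α ⊕ β → Prop
  | .inl none => True
  | .inl (some a) => v a ≤ u
  | .inr b => M ∣ (X b).choose (u + 1)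

theorem bq_core {α β : Type} (p : Poly (Option α ⊕ β)) (L : Finset (Option α ⊕ β)) (c d : ℕ)
    (hL : ∀ (z : Option α ⊕ β → ℕ) (u : ℕ), (∀ i ∈ L, z i ≤ u) →
      (p z).natAbs ≤ c * (u + 1) ^ d) (n : ℕ) (v : α → ℕ) :
    (∀ k < n, ∃ t : β → ℕ, p (Sum.elim (Option.elim' k v) t) = 0) ↔
    ∃ u q, n ≤ u ∧ q = ((c * (u + 1) ^ d + u + 3)!) * ((c * (u + 1) ^ d + u + 3)!) - 1 ∧
      ∃ X : β → ℕ, (∀ i ∈ L, Cond (q.choose n) u v X i) ∧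
        q.choose n ∣ (p (Sum.elim (Option.elim' q v) X)).natAbs := by
  constructor
  · intro h
    choose! t ht using h
    -- bound
    obtain ⟨u, hnu, hu⟩ : ∃ u, n ≤ u ∧ ∀ i ∈ L, ∀ k < n,
        (Sum.elim (Option.elim' k v) (t k) : Option α ⊕ β → ℕ) i ≤ u := by
      refine ⟨n + ∑ i ∈ L, ∑ k ∈ Finset.range n,
        (Sum.elim (Option.elim' k v) (t k) : Option α ⊕ β → ℕ) i , by omega,
        fun i hi k hk => ?_⟩
      have h1 := Finset.single_le_sum (f := fun i => ∑ k ∈ Finset.range n,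
        (Sum.elim (Option.elim' k v) (t k) : Option α ⊕ β → ℕ) i) (fun i _ => Nat.zero_le _) hi
      have h2 := Finset.single_le_sum (f := fun k => 
        (Sum.elim (Option.elim' k v) (t k) : Option α ⊕ β → ℕ) i) (fun i _ => Nat.zero_le _)
        (Finset.mem_range.2 hk)
      omega
    obtain ⟨u', hnu', hu'⟩ : ∃ u', u ≤ u' ∧ ∀ a, Sum.inl (some a) ∈ L → v a ≤ u' := by
      refine ⟨u + ∑ i ∈ L, (Sum.elim (Option.elim' 0 v) (t 0) : Option α ⊕ β → ℕ) i, by omega,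
        fun a ha => ?_⟩
      have h1 := Finset.single_le_sum (f := fun i => 
        (Sum.elim (Option.elim' 0 v) (t 0) : Option α ⊕ β → ℕ) i) (fun i _ => Nat.zero_le _) ha
      simp at h1
      omega
    set U := c * (u' + 1) ^ d + u' + 3 with hU
    obtain ⟨m, hM, hq, hm1, hmp, hmc⟩ := moduli U n (by omega) (by omega)
    refine ⟨u', _, by omega, rfl, ?_⟩
    choose X hX using fun b => crt n m hm1 hmc (fun k => t k b)
    refine ⟨X, ?_, ?_⟩
    · intro i hi
      rcases i with (_ | a) | b
      · trivial
      · exact hu' a hi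
      · change _ ∣ _
        rw [hM]
        refine prod_dvd_iff n m hmc _ fun k hk => ?_
        refine dvd_choose_of_modEq ((hu _ hi k hk).trans hnu') (hX b k hk) fun p pp hp => ?_
        have := hmp k hk p pp hp
        omega
    · rw [hM]
      refine prod_dvd_iff n m hmc _ fun k hk => ?_
      rw [← Int.natCast_dvd, ← Int.modEq_zero_iff_dvd, ← ht k hk]
      refine poly_modEq p.isPoly _ _ _ ?_
      rintro ((_ | a) | b)
      · exact hq k hk
      · rfl
      · exact hX b k hk
  · rintro ⟨u, q, hnu, hqd, X, hC, hd⟩ k hk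
    set U := c * (u + 1) ^ d + u + 3 with hU
    obtain ⟨m, hM, hq, hm1, hmp, hmc⟩ := moduli U n (by omega) (by omega)
    rw [← hqd] at hM hq
    obtain ⟨r, rp, hr⟩ := Nat.exists_prime_and_dvd (hm1 k hk).ne'
    have hrU := hmp k hk r rp hr
    have hrM : r ∣ q.choose n := by
      rw [hM]; exact hr.trans (Finset.dvd_prod_of_mem _ (Finset.mem_range.2 hk))
    refine ⟨fun b => X b % r, ?_⟩
    have hb : (p (Sum.elim (Option.elim' k v) (fun b => X b % r))).natAbs ≤ c * (u + 1) ^ d := by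
      refine hL _ u fun i hi => ?_
      have := hC i hi
      rcases i with (_ | a) | b
      · simp; omega
      · exact this
      · exact dvd_choose_bound rp (hrM.trans this)
    have h1 : r ∣ (p (Sum.elim (Option.elim' k v) (fun b => X b % r))).natAbs := by
      have h0 := hrM.trans hd
      rw [← Int.natCast_dvd, ← Int.modEq_zero_iff_dvd] at h0 ⊢
      refine Int.ModEq.trans ?_ h0
      refine poly_modEq p.isPoly _ _ _ ?_
      rintro ((_ | a) | b)
      · exact ((hq k hk).of_dvd hr).symm
      · rfl
      · exact Nat.mod_modEq _ _
    rw [← Int.natAbs_eq_zero]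
    exact Nat.eq_zero_of_dvd_of_lt h1 (by omega)

/-- The bounded universal quantifier theorem. -/
theorem ball_dioph {α : Type} {S : Set (Option α → ℕ)} (hS : Dioph S) {f : (α → ℕ) → ℕ}
    (hf : DiophFn f) : Dioph {v : α → ℕ | ∀ k < f v, (Option.elim' k v : Option α → ℕ) ∈ S} := by
  obtain ⟨β, p, hp⟩ := hS
  obtain ⟨L, c, d, hL⟩ := poly_bound p.isPoly
  suffices h : Dioph {v : α → ℕ | ∃ u q, f v ≤ u ∧
      q = ((c * (u + 1) ^ d + u + 3)!) * ((c * (u + 1) ^ d + u + 3)!) - 1 ∧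
      ∃ X : β → ℕ, (∀ i ∈ L, Cond (q.choose (f v)) u v X i) ∧
        q.choose (f v) ∣ (p (Sum.elim (Option.elim' q v) X)).natAbs} by
    refine h.ext fun v => Iff.symm ?_
    refine Iff.trans ?_ (bq_core p L c d hL (f v) v)
    simp only [Set.mem_ofPred_eq, hp]
  apply ex1 (P := fun u v => ∃ q, f v ≤ u ∧
      q = ((c * (u + 1) ^ d + u + 3)!) * ((c * (u + 1) ^ d + u + 3)!) - 1 ∧
      ∃ X : β → ℕ, (∀ i ∈ L, Cond (q.choose (f v)) u v X i) ∧
        q.choose (f v) ∣ (p (Sum.elim (Option.elim' q v) X)).natAbs)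
  apply ex1 (P := fun q w => f (w ∘ some) ≤ w none ∧
      q = ((c * (w none + 1) ^ d + w none + 3)!) * ((c * (w none + 1) ^ d + w none + 3)!) - 1 ∧
      ∃ X : β → ℕ, (∀ i ∈ L, Cond (q.choose (f (w ∘ some))) (w none) (w ∘ some) X i) ∧
        q.choose (f (w ∘ some)) ∣ (p (Sum.elim (Option.elim' q (w ∘ some)) X)).natAbs)
  -- index: none = q, some none = u, some (some a) = v a
  have hfac : DiophFn fun w : Option (Option α) → ℕ =>
      (c * (w (some none) + 1) ^ d + w (some none) + 3)! :=
    factorial_dioph (add_dioph (add_dioph (mul_dioph (const_dioph c)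
      (pow_dioph (add_dioph (proj_dioph _) (const_dioph 1)) (const_dioph d))) (proj_dioph _))
      (const_dioph 3))
  refine Dioph.inter (le_dioph (reindex_diophFn (some ∘ some) hf) (proj_dioph _))
    (Dioph.inter (eq_dioph (proj_dioph _) (sub_dioph (mul_dioph hfac hfac) (const_dioph 1))) ?_)
  apply exf (P := fun X w =>
    (∀ i ∈ L, Cond ((w none).choose (f (w ∘ some ∘ some))) (w (some none)) (w ∘ some ∘ some) X i) ∧
        (w none).choose (f (w ∘ some ∘ some)) ∣
          (p (Sum.elim (Option.elim' (w none) (w ∘ some ∘ some)) X)).natAbs)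
  have hM : DiophFn fun w : Option (Option α) ⊕ β → ℕ =>
      (w (Sum.inl none)).choose (f (w ∘ Sum.inl ∘ some ∘ some)) :=
    choose_dioph (proj_dioph _) (reindex_diophFn _ hf)
  refine Dioph.inter (finset_dioph L (fun i => {w : Option (Option α) ⊕ β → ℕ |
    Cond ((w (Sum.inl none)).choose (f (w ∘ Sum.inl ∘ some ∘ some))) (w (Sum.inl (some none)))
      (w ∘ Sum.inl ∘ some ∘ some) (w ∘ Sum.inr) i}) ?_) ?_
  · rintro ((_ | a) | b) -
    · exact univ_dioph.ext fun v => by simp [Cond]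
    · exact le_dioph (proj_dioph _) (proj_dioph _)
    · exact dvd_dioph hM (choose_dioph (proj_dioph _) (add_dioph (proj_dioph _) (const_dioph 1)))
  · refine dvd_dioph hM ?_
    let e : Option α ⊕ β → Option (Option α) ⊕ β :=
      Sum.elim (Option.elim' (Sum.inl none) (Sum.inl ∘ some ∘ some)) Sum.inr
    have := reindex_diophFn e (abs_poly_dioph p)
    convert! this using 4 with w
    ext i
    rcases i with (_ | a) | b <;> rfl

end H10


namespace H10
open Nat Dioph

theorem diophFn_subst {α γ : Type} [Fintype γ] {f : (γ → ℕ) → ℕ} (hf : DiophFn f)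
    (ψ : γ → (α → ℕ) → ℕ) (h : ∀ i, DiophFn (ψ i)) : DiophFn fun v => f (fun i => ψ i v) := by
  have := subst_dioph (α := Option α) (γ := Option γ) hf
    (Option.elim' (fun w => w none) (fun i w => ψ i (w ∘ some))) (by
      rintro (_ | i)
      · exact proj_dioph _
      · exact reindex_diophFn some (h i))
  exact this

theorem beta_exists (F : ℕ → ℕ) (N : ℕ) : ∃ a b : ℕ, ∀ i ≤ N, a % ((i + 1) * b + 1) = F i := by
  let l := List.ofFn (fun i : Fin (N + 1) => F i)
  refine ⟨(Nat.unbeta l).unpair.1, (Nat.unbeta l).unpair.2, fun i hi => ?_⟩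
  have := Nat.beta_unbeta_coe l ⟨i, by simp [l]; omega⟩
  have h2 : l[(⟨i, by simp [l]; omega⟩ : Fin l.length)] = F i := by
    change l[i]'(by simp [l]; omega) = F i
    simp only [l, List.getElem_ofFn]
  rw [h2] at this
  exact this

theorem primrec_dioph {n : ℕ} {f : List.Vector ℕ n → ℕ} (hf : Nat.Primrec' f) :
    DiophFn fun v : Fin n → ℕ => f (List.Vector.ofFn v) := by
  induction hf with
  | zero => exact const_dioph 0
  | succ =>
    simp only [List.Vector.head_ofFn]
    exact add_dioph (proj_dioph 0) (const_dioph 1)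
  | get i =>
    simp only [List.Vector.get_ofFn]
    exact proj_dioph i
  | @comp m n f g _ _ ihf ihg =>
    exact diophFn_subst ihf _ ihg
  | @prec n f g _ _ ihf ihg =>
    suffices h : Dioph {w : Option (Fin (n + 1)) → ℕ | ∃ a b : ℕ, 
        a % ((0 + 1) * b + 1) = f (List.Vector.ofFn fun i : Fin n => w (some i.succ)) ∧
        a % ((w (some 0) + 1) * b + 1) = w none ∧
        ∀ i < w (some 0), a % ((i + 1 + 1) * b + 1) =
          g (List.Vector.ofFn (Fin.cons i (Fin.cons (a % ((i + 1) * b + 1)) fun i : Fin n => w (some i.succ)) :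
            Fin (n + 2) → ℕ))} by
      refine h.ext fun w => ?_
      simp only [Set.mem_ofPred_eq]
      have ht : (List.Vector.ofFn (w ∘ some)).tail = List.Vector.ofFn fun i : Fin n => w (some i.succ) := by
        rw [List.Vector.tail_ofFn]; rfl
      have hh : (List.Vector.ofFn (w ∘ some)).head = w (some 0) := by
        rw [List.Vector.head_ofFn]; rfl
      rw [ht, hh]
      set T := List.Vector.ofFn fun i : Fin n => w (some i.succ) with hT
      have hcons : ∀ i j : ℕ, List.Vector.ofFn (Fin.cons i (Fin.cons j fun i : Fin n => w (some i.succ)) :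
            Fin (n + 2) → ℕ) = i ::ᵥ j ::ᵥ T := by
        intro i j
        rw [List.Vector.ofFn, List.Vector.ofFn]; rfl
      simp only [hcons]
      constructor
      · rintro ⟨a, b, h0, hN, hs⟩
        rw [← hN]
        have : ∀ i ≤ w (some 0), (Nat.rec (f T) (fun y IH => g (y ::ᵥ IH ::ᵥ T)) i : ℕ) =
            a % ((i + 1) * b + 1) := by
          intro i
          induction i with
          | zero => intro _; exact h0.symm
          | succ i ih =>
            intro hi
            rw [hs i (by omega), ← ih (by omega)]
        exact this _ le_rfl
      · intro h
        obtain ⟨a, b, hab⟩ := beta_exists 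
          (fun i => (Nat.rec (f T) (fun y IH => g (y ::ᵥ IH ::ᵥ T)) i : ℕ)) (w (some 0))
        refine ⟨a, b, hab 0 (by omega), (hab _ le_rfl).trans h, fun i hi => ?_⟩
        rw [hab (i + 1) (by omega), hab i (by omega)]
    apply ex1 (P := fun a w => ∃ b : ℕ, 
        a % ((0 + 1) * b + 1) = f (List.Vector.ofFn fun i : Fin n => w (some i.succ)) ∧
        a % ((w (some 0) + 1) * b + 1) = w none ∧
        ∀ i < w (some 0), a % ((i + 1 + 1) * b + 1) =
          g (List.Vector.ofFn (Fin.cons i (Fin.cons (a % ((i + 1) * b + 1)) fun i : Fin n => w (some i.succ)) :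
            Fin (n + 2) → ℕ)))
    apply ex1 (P := fun b w =>
        (w none) % ((0 + 1) * b + 1) = f (List.Vector.ofFn fun i : Fin n => w (some (some i.succ))) ∧
        (w none) % ((w (some (some 0)) + 1) * b + 1) = w (some none) ∧
        ∀ i < w (some (some 0)), (w none) % ((i + 1 + 1) * b + 1) =
          g (List.Vector.ofFn (Fin.cons i (Fin.cons ((w none) % ((i + 1) * b + 1))
            fun i : Fin n => w (some (some i.succ))) : Fin (n + 2) → ℕ)))
    -- none = b, some none = a, some some none = y, some some some i = v i
    refine Dioph.inter (eq_dioph (mod_dioph (proj_dioph _) (add_dioph (mul_dioph (const_dioph (0 + 1))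
      (proj_dioph _)) (const_dioph 1))) ?_) (Dioph.inter (eq_dioph (mod_dioph (proj_dioph _)
      (add_dioph (mul_dioph (add_dioph (proj_dioph _) (const_dioph 1))
      (proj_dioph _)) (const_dioph 1))) (proj_dioph _)) ?_)
    · exact reindex_diophFn (fun i : Fin n => some (some (some i.succ))) ihf
    · let V := Option (Option (Option (Option (Fin (n + 1)))))
      have hseq : DiophFn fun x : V → ℕ => x (some (some none)) % ((x none + 1) * x (some none) + 1) :=
        mod_dioph (proj_dioph _) (add_dioph (mul_dioph (add_dioph (proj_dioph _) (const_dioph 1))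
          (proj_dioph _)) (const_dioph 1))
      have hseq' : DiophFn fun x : V → ℕ => x (some (some none)) % ((x none + 1 + 1) * x (some none) + 1) :=
        mod_dioph (proj_dioph _) (add_dioph (mul_dioph (add_dioph (add_dioph (proj_dioph _)
          (const_dioph 1)) (const_dioph 1)) (proj_dioph _)) (const_dioph 1))
      have hg : DiophFn fun x : V → ℕ => g (List.Vector.ofFn (fun j : Fin (n + 2) =>
          (Fin.cons (x none) (Fin.cons (x (some (some none)) % ((x none + 1) * x (some none) + 1))
            fun i : Fin n => x (some (some (some (some i.succ))))) : Fin (n + 2) → ℕ) j)) := by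
        refine diophFn_subst ihg (fun j x => 
          (Fin.cons (x none) (Fin.cons (x (some (some none)) % ((x none + 1) * x (some none) + 1))
            fun i : Fin n => x (some (some (some (some i.succ))))) : Fin (n + 2) → ℕ) j) ?_
        intro j
        refine Fin.cases ?_ (fun j => Fin.cases ?_ (fun j => ?_) j) j
        · exact proj_dioph _
        · exact hseq
        · exact proj_dioph (some (some (some (some j.succ))))
      exact ball_dioph (eq_dioph hseq' hg) (proj_dioph (some (some (some 0))))

theorem mem_mOfFn {n : ℕ} (g : Fin n → Part ℕ) (z : List.Vector ℕ n) :
    z ∈ (List.Vector.mOfFn g : Part (List.Vector ℕ n)) ↔ ∀ i, z.get i ∈ g i := by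
  induction n with
  | zero =>
    simp [List.Vector.mOfFn, pure, List.Vector.eq_nil]
  | succ n ih =>
    simp only [List.Vector.mOfFn, Part.bind_eq_bind, Part.mem_bind_iff, ih, Part.pure_eq_some, Part.mem_some_iff]
    constructor
    · rintro ⟨a, ha, b, hb, rfl⟩ i
      refine Fin.cases ?_ (fun i => ?_) i
      · simpa using ha
      · simpa using hb i
    · intro h
      refine ⟨z.head, by simpa using h 0, z.tail, fun i => by simpa using h i.succ, by simp⟩

theorem partrec_dioph {n : ℕ} {f : List.Vector ℕ n →. ℕ} (hf : Nat.Partrec' f) :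
    Dioph {w : Option (Fin n) → ℕ | w none ∈ f (List.Vector.ofFn (w ∘ some))} := by
  induction hf with
  | prim h =>
    refine (primrec_dioph h).ext fun w => ?_
    simp [eq_comm]
  | @comp m n f g _ _ ihf ihg =>
    have : Dioph {w : Option (Fin m) → ℕ | ∃ z : Fin n → ℕ,
        (∀ i, z i ∈ g i (List.Vector.ofFn (w ∘ some))) ∧ w none ∈ f (List.Vector.ofFn z)} := by
      apply exf (P := fun z w => (∀ i, z i ∈ g i (List.Vector.ofFn (w ∘ some))) ∧
        w none ∈ f (List.Vector.ofFn z))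
      refine Dioph.inter (all_dioph (fun i => {w : Option (Fin m) ⊕ Fin n → ℕ |
        w (Sum.inr i) ∈ g i (List.Vector.ofFn (w ∘ Sum.inl ∘ some))}) fun i => ?_) ?_
      · exact reindex_dioph _ (Option.elim' (Sum.inr i) (Sum.inl ∘ some)) (ihg i)
      · exact reindex_dioph _ (Option.elim' (Sum.inl none) Sum.inr) ihf
    refine this.ext fun w => ?_
    refine Iff.trans ?_ Part.mem_bind_iff.symm
    constructor
    · rintro ⟨z, h1, h2⟩
      exact ⟨List.Vector.ofFn z, (mem_mOfFn _ _).2 (by simpa using h1), h2⟩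
    · rintro ⟨z, h1, h2⟩
      exact ⟨z.get, (mem_mOfFn _ _).1 h1, by simpa using h2⟩
  | @rfind n f _ ih =>
    have hf : DiophFn fun v : Fin (n + 1) → ℕ => f (List.Vector.ofFn v) := by
      refine Dioph.ext ih fun w => ?_
      simp [eq_comm]
    have h1 : DiophFn fun w : Option (Fin n) → ℕ => f (w none ::ᵥ List.Vector.ofFn (w ∘ some)) :=
      reindex_diophFn (Fin.cons none some : Fin (n + 1) → Option (Fin n)) hf
    have h2 : Dioph {w : Option (Fin n) → ℕ | ∀ k < w none,
        f (k ::ᵥ List.Vector.ofFn (w ∘ some)) ≠ 0} :=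
      ball_dioph (S := {x : Option (Option (Fin n)) → ℕ |
        f (x none ::ᵥ List.Vector.ofFn (x ∘ some ∘ some)) ≠ 0})
        (ne_dioph (reindex_diophFn (Option.elim' none (some ∘ some)) h1) (const_dioph 0)) (proj_dioph none)
    refine ((eq_dioph h1 (const_dioph 0)).inter h2).ext fun w => ?_
    refine Iff.trans ?_ Nat.mem_rfind.symm
    refine and_congr ?_ (forall_congr' fun k => forall_congr' fun hk => ?_)
    · exact Iff.trans (by simp) Part.mem_some_iff.symm
    · exact Iff.trans (by simp) Part.mem_some_iff.symm

theorem computable_dioph {g : ℕ → ℕ} (hg : Computable g) :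
    Dioph {w : Option (Fin 1) → ℕ | w none = g (w (some 0))} := by
  have h : Nat.Partrec' (fun v : List.Vector ℕ 1 => (g : ℕ →. ℕ) v.head) :=
    Nat.Partrec'.part_iff₁.2 hg
  refine (partrec_dioph h).ext fun w => ?_
  simp

end H10


namespace H10
open Nat

/-- Solution sets of systems of basic equations over an arbitrary variable type. -/
inductive Sys {V : Type} : Set (V → ℕ) → Prop
  | one (k : V) : Sys {y | y k = 1}
  | add (i j k : V) : Sys {y | y i + y j = y k}
  | mul (i j k : V) : Sys {y | y i * y j = y k}
  | all {ι : Type} (T : ι → Set (V → ℕ)) : (∀ i, Sys (T i)) → Sys {y | ∀ i, y ∈ T i}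

theorem Sys.ext {V : Type} {T T' : Set (V → ℕ)} (h : Sys T) (e : ∀ y, y ∈ T ↔ y ∈ T') : Sys T' := by
  rwa [← Set.ext e]

theorem Sys.inter {V : Type} {T T' : Set (V → ℕ)} (h : Sys T) (h' : Sys T') :
    Sys {y | y ∈ T ∧ y ∈ T'} := by
  refine (Sys.all (fun b : Bool => if b then T else T') ?_).ext fun y => ?_
  · intro b; cases b <;> simpa
  · simp [and_comm]

theorem Sys.imp {V : Type} {T : Set (V → ℕ)} (p : Prop) (h : p → Sys T) :
    Sys {y | p → y ∈ T} := by
  refine (Sys.all (fun _ : PLift p => T) fun b => h b.down).ext fun y => ?_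
  exact ⟨fun h hp => h ⟨hp⟩, fun h hp => h hp.down⟩

theorem Sys.reindex {V W : Type} (e : V → W) {T : Set (V → ℕ)} (h : Sys T) :
    Sys {y : W → ℕ | y ∘ e ∈ T} := by
  induction h with
  | one k => exact Sys.one (e k)
  | add i j k => exact Sys.add (e i) (e j) (e k)
  | mul i j k => exact Sys.mul (e i) (e j) (e k)
  | all T _ ih => exact Sys.all _ ih

theorem Sys.exists_eqn {n : ℕ} {T : Set (Fin n → ℕ)} (h : Sys T) :
    ∃ S : Set (Eqn n), ∀ y, Solves S y ↔ y ∈ T := by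
  induction h with
  | one k => exact ⟨{Eqn.one k}, fun y => by simp [Solves, Eqn.Holds]⟩
  | add i j k => exact ⟨{Eqn.add i j k}, fun y => by simp [Solves, Eqn.Holds]⟩
  | mul i j k => exact ⟨{Eqn.mul i j k}, fun y => by simp [Solves, Eqn.Holds]⟩
  | all T _ ih =>
    choose S hS using ih
    refine ⟨⋃ i, S i, fun y => ?_⟩
    simp only [Set.mem_ofPred_eq, ← hS]
    simp only [Solves, Set.mem_iUnion]
    exact ⟨fun h i e he => h e ⟨i, he⟩, fun h e ⟨i, he⟩ => h i e he⟩

/-- `y` takes the values of `x` on the slots labelled with variables. -/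
def Compat {V γ : Type} (vars : V → Option γ) (y : V → ℕ) (x : γ → ℕ) : Prop :=
  ∀ i g, vars i = some g → y i = x g

/-- `f` is computed as a difference of two variables of a system of basic equations. -/
def Rep {γ : Type} (f : (γ → ℕ) → ℤ) : Prop :=
  ∃ (V : Type) (_ : Fintype V) (vars : V → Option γ) (a b : V) (T : Set (V → ℕ)), Sys T ∧
    (∀ y ∈ T, ∀ x, Compat vars y x → f x = (y a : ℤ) - y b) ∧
    ∀ x, ∃ y ∈ T, Compat vars y x

theorem Rep.proj {γ : Type} (g : γ) : Rep fun x : γ → ℕ => (x g : ℤ) := by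
  refine ⟨Bool, inferInstance, fun b => if b then some g else none, true, false,
    {y | y false + y false = y false}, Sys.add _ _ _, ?_, ?_⟩
  · intro y hy x hc
    have h1 := hc true g (by simp)
    simp at hy
    simp [h1, hy]
  · intro x
    refine ⟨fun b => if b then x g else 0, by simp, ?_⟩
    rintro (_ | _) g' h <;> simp at h
    subst h; simp

theorem Rep.one {γ : Type} : Rep fun _ : γ → ℕ => (1 : ℤ) := by
  refine ⟨Bool, inferInstance, fun b => none, true, false,
    {y | y ∈ {y : Bool → ℕ | y true = 1} ∧ y ∈ {y : Bool → ℕ | y false + y false = y false}},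
    Sys.inter (Sys.one _) (Sys.add _ _ _), ?_, ?_⟩
  · intro y hy x hc
    simp at hy
    simp [hy]
  · intro x
    refine ⟨fun b => if b then 1 else 0, by simp, ?_⟩
    intro _ g' h; simp at h

/-- Labels of the slots of a combined system. -/
def cvars {V₁ V₂ W γ : Type} (v₁ : V₁ → Option γ) (v₂ : V₂ → Option γ) :
    (V₁ ⊕ V₂) ⊕ W → Option γ :=
  Sum.elim (Sum.elim v₁ v₂) fun _ => none

theorem cvars_compat {V₁ V₂ W γ : Type} {v₁ : V₁ → Option γ} {v₂ : V₂ → Option γ}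
    {y : (V₁ ⊕ V₂) ⊕ W → ℕ} {x : γ → ℕ} :
    Compat (cvars v₁ v₂) y x ↔ Compat v₁ (y ∘ Sum.inl ∘ Sum.inl) x ∧
      Compat v₂ (y ∘ Sum.inl ∘ Sum.inr) x := by
  constructor
  · intro h
    exact ⟨fun i g hi => h (Sum.inl (Sum.inl i)) g hi, fun i g hi => h (Sum.inl (Sum.inr i)) g hi⟩
  · rintro ⟨h1, h2⟩ ((i | i) | i) g hi
    · exact h1 i g hi
    · exact h2 i g hi
    · simp [cvars] at hi

theorem Rep.sub {γ : Type} {f g : (γ → ℕ) → ℤ} (hf : Rep f) (hg : Rep g) :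
    Rep fun x => f x - g x := by
  obtain ⟨V₁, _, v₁, a₁, b₁, T₁, s₁, p₁, q₁⟩ := hf
  obtain ⟨V₂, _, v₂, a₂, b₂, T₂, s₂, p₂, q₂⟩ := hg
  let W := (V₁ ⊕ V₂) ⊕ Bool
  let l : V₁ → W := Sum.inl ∘ Sum.inl
  let r : V₂ → W := Sum.inl ∘ Sum.inr
  refine ⟨W, inferInstance, cvars v₁ v₂, Sum.inr true, Sum.inr false, _,
    (s₁.reindex l).inter ((s₂.reindex r).inter ((Sys.add (l a₁) (r b₂) (Sum.inr true)).inter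
      (Sys.add (l b₁) (r a₂) (Sum.inr false)))), ?_, ?_⟩
  · rintro y ⟨h1, h2, h3, h4⟩ x hc
    rw [cvars_compat] at hc
    have e1 := p₁ _ h1 x hc.1
    have e2 := p₂ _ h2 x hc.2
    simp only [Set.mem_ofPred_eq] at h3 h4
    rw [← h3, ← h4]
    simp only [e1, e2, Function.comp]
    push_cast; ring
  · intro x
    obtain ⟨y₁, h1, c1⟩ := q₁ x
    obtain ⟨y₂, h2, c2⟩ := q₂ x
    exact ⟨Sum.elim (Sum.elim y₁ y₂) (fun b => if b then y₁ a₁ + y₂ b₂ else y₁ b₁ + y₂ a₂),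
      ⟨h1, h2, rfl, rfl⟩, cvars_compat.2 ⟨c1, c2⟩⟩

theorem Rep.mul {γ : Type} {f g : (γ → ℕ) → ℤ} (hf : Rep f) (hg : Rep g) :
    Rep fun x => f x * g x := by
  obtain ⟨V₁, _, v₁, a₁, b₁, T₁, s₁, p₁, q₁⟩ := hf
  obtain ⟨V₂, _, v₂, a₂, b₂, T₂, s₂, p₂, q₂⟩ := hg
  let W := (V₁ ⊕ V₂) ⊕ Fin 6
  let l : V₁ → W := Sum.inl ∘ Sum.inl
  let r : V₂ → W := Sum.inl ∘ Sum.inr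
  let n : Fin 6 → W := Sum.inr
  refine ⟨W, inferInstance, cvars v₁ v₂, n 4, n 5, _,
    (s₁.reindex l).inter ((s₂.reindex r).inter ((Sys.mul (l a₁) (r a₂) (n 0)).inter
      ((Sys.mul (l b₁) (r b₂) (n 1)).inter ((Sys.mul (l a₁) (r b₂) (n 2)).inter
      ((Sys.mul (l b₁) (r a₂) (n 3)).inter ((Sys.add (n 0) (n 1) (n 4)).inter
      (Sys.add (n 2) (n 3) (n 5)))))))), ?_, ?_⟩
  · rintro y ⟨h1, h2, h3, h4, h5, h6, h7, h8⟩ x hc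
    rw [cvars_compat] at hc
    have e1 := p₁ _ h1 x hc.1
    have e2 := p₂ _ h2 x hc.2
    simp only [Set.mem_ofPred_eq] at h3 h4 h5 h6 h7 h8
    rw [← h7, ← h8, ← h3, ← h4, ← h5, ← h6]
    simp only [e1, e2, Function.comp, l, r]
    push_cast; ring
  · intro x
    obtain ⟨y₁, h1, c1⟩ := q₁ x
    obtain ⟨y₂, h2, c2⟩ := q₂ x
    exact ⟨Sum.elim (Sum.elim y₁ y₂) ![y₁ a₁ * y₂ a₂, y₁ b₁ * y₂ b₂, y₁ a₁ * y₂ b₂, y₁ b₁ * y₂ a₂,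
        y₁ a₁ * y₂ a₂ + y₁ b₁ * y₂ b₂, y₁ a₁ * y₂ b₂ + y₁ b₁ * y₂ a₂],
      ⟨h1, h2, rfl, rfl, rfl, rfl, rfl, rfl⟩, cvars_compat.2 ⟨c1, c2⟩⟩

theorem Rep.const {γ : Type} (n : ℤ) : Rep fun _ : γ → ℕ => n := by
  have h0 : Rep fun _ : γ → ℕ => (0 : ℤ) := by simpa using Rep.one.sub (Rep.one (γ := γ))
  have hm : Rep fun _ : γ → ℕ => (0 - 1 : ℤ) := h0.sub Rep.one
  induction n using Int.induction_on with
  | zero => exact h0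
  | succ i ih => simpa using ih.sub hm
  | pred i ih => exact ih.sub Rep.one

theorem Rep.of_isPoly {γ : Type} {f : (γ → ℕ) → ℤ} (hf : IsPoly f) : Rep f := by
  induction hf with
  | proj i => exact Rep.proj i
  | const n => exact Rep.const n
  | sub _ _ h1 h2 => exact h1.sub h2
  | mul _ _ h1 h2 => exact h1.mul h2

theorem fOmega1_spec (n : ℕ) (S : Set (Eqn n)) (h : ∃ x : Fin n → ℕ, Solves S x) :
    ∃ x : Fin n → ℕ, Solves S x ∧ ∀ i, x i ≤ fOmega1 n := by
  have hfin : Finite (Eqn n) := by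
    let e : Eqn n → Fin n ⊕ (Fin n × Fin n × Fin n) ⊕ (Fin n × Fin n × Fin n)
      | .one k => Sum.inl k
      | .add i j k => Sum.inr (Sum.inl (i, j, k))
      | .mul i j k => Sum.inr (Sum.inr (i, j, k))
    refine Finite.of_injective e ?_
    rintro (_ | _ | _) (_ | _ | _) h <;> simp [e] at h <;> simp [h]
  have hne : {b : ℕ | ∀ S : Set (Eqn n), (∃ x : Fin n → ℕ, Solves S x) →
      ∃ x : Fin n → ℕ, Solves S x ∧ ∀ i, x i ≤ b}.Nonempty := by
    have : ∀ S : Set (Eqn n), ∃ b : ℕ, (∃ x : Fin n → ℕ, Solves S x) →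
        ∃ x : Fin n → ℕ, Solves S x ∧ ∀ i, x i ≤ b := by
      intro S
      by_cases hS : ∃ x : Fin n → ℕ, Solves S x
      · obtain ⟨x, hx⟩ := hS
        exact ⟨∑ i, x i, fun _ => ⟨x, hx, fun i =>
          Finset.single_le_sum (fun _ _ => Nat.zero_le _) (Finset.mem_univ i)⟩⟩
      · exact ⟨0, fun h => absurd h hS⟩
    choose b hb using this
    have := Fintype.ofFinite (Set (Eqn n))
    refine ⟨∑ S, b S, fun S hS => ?_⟩
    obtain ⟨x, hx, hle⟩ := hb S hS
    exact ⟨x, hx, fun i => (hle i).trans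
      (Finset.single_le_sum (f := b) (fun _ _ => Nat.zero_le _) (Finset.mem_univ S))⟩
  exact Nat.sInf_mem hne S h

theorem lower_bound {g : ℕ → ℕ} (hg : Computable g) : ∃ c, ∀ t, g t ≤ fOmega1 (t + c) := by
  obtain ⟨β, p, hp⟩ := computable_dioph hg
  obtain ⟨V, _, vars, a, b, T, hT, h1, h2⟩ := Rep.of_isPoly p.isPoly
  refine ⟨Fintype.card V + 3, fun t => ?_⟩
  let W := V ⊕ (Fin (t + 1) ⊕ Bool)
  let ch : Fin (t + 1) → W := fun i => Sum.inr (Sum.inl i)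
  let on : W := Sum.inr (Sum.inr true)
  let out : W := Sum.inr (Sum.inr false)
  -- the system
  let Z : Set (W → ℕ) := {y | y ∘ Sum.inl ∈ T ∧ y on = 1 ∧ y (ch 0) + y (ch 0) = y (ch 0) ∧
    (∀ i : Fin t, y (ch i.castSucc) + y on = y (ch i.succ)) ∧
    (∀ i, vars i = some (Sum.inl (some 0)) → y (ch 0) + y (ch (Fin.last t)) = y (Sum.inl i)) ∧
    (∀ i, vars i = some (Sum.inl none) → y (ch 0) + y out = y (Sum.inl i)) ∧
    (∀ i j, (vars i = vars j ∧ vars i ≠ none) → y (ch 0) + y (Sum.inl i) = y (Sum.inl j)) ∧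
    y (ch 0) + y (Sum.inl a) = y (Sum.inl b)}
  have hZ : Sys Z := by
    refine (hT.reindex Sum.inl).inter ((Sys.one on).inter ((Sys.add _ _ _).inter
      ((Sys.all (fun i : Fin t => {y | y (ch i.castSucc) + y on = y (ch i.succ)})
        fun i => Sys.add _ _ _).inter
      ((Sys.all (fun i => {y | vars i = some (Sum.inl (some 0)) →
          y ∈ {y : W → ℕ | y (ch 0) + y (ch (Fin.last t)) = y (Sum.inl i)}})
        fun i => Sys.imp _ fun _ => Sys.add _ _ _).inter
      ((Sys.all (fun i => {y | vars i = some (Sum.inl none) →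
          y ∈ {y : W → ℕ | y (ch 0) + y out = y (Sum.inl i)}})
        fun i => Sys.imp _ fun _ => Sys.add _ _ _).inter
      ((Sys.all (fun i => {y | ∀ j, y ∈ {y | (vars i = vars j ∧ vars i ≠ none) →
          y ∈ {y : W → ℕ | y (ch 0) + y (Sum.inl i) = y (Sum.inl j)}}})
        fun i => Sys.all _ fun j => Sys.imp _ fun _ => Sys.add _ _ _).inter
      (Sys.add _ _ _)))))))
  -- every solution has the right output
  have hout : ∀ y ∈ Z, y out = g t := by
    classical
    rintro y ⟨hyT, hon, h0, hch, hin, hou, heq, hab⟩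
    have h0 : y (ch 0) = 0 := by omega
    have hchain : ∀ i : Fin (t + 1), y (ch i) = i := by
      intro i
      induction i using Fin.induction with
      | zero => simpa using h0
      | succ i ih => rw [← hch i, ih, hon]; simp
    have hlast := hchain (Fin.last t)
    simp only [Fin.val_last] at hlast
    simp only [h0, zero_add] at hin hou heq hab
    let x2 : β → ℕ := fun s => if h : ∃ i, vars i = some (Sum.inr s) then y (Sum.inl h.choose) else 0
    let x1 : Option (Fin 1) → ℕ := Option.elim' (y out) (fun _ => t)
    have hc : Compat vars (y ∘ Sum.inl) (Sum.elim x1 x2) := by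
      rintro i ((_ | k) | s) hi
      · exact (hou i hi).symm
      · have : k = 0 := Subsingleton.elim _ _
        subst this
        exact (hin i hi).symm.trans hlast
      · have hex : ∃ i, vars i = some (Sum.inr s) := ⟨i, hi⟩
        change y (Sum.inl i) = x2 s
        simp only [x2, dif_pos hex]
        exact heq i _ ⟨hi.trans hex.choose_spec.symm, by simp [hi]⟩
    have hz := h1 _ hyT _ hc
    have hz0 : p (Sum.elim x1 x2) = 0 := by
      refine hz.trans ?_
      simp only [Function.comp]; rw [hab]; ring
    exact (hp x1).2 ⟨x2, hz0⟩
  -- there is a solution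
  have hex : ∃ y, y ∈ Z := by
    let x1 : Option (Fin 1) → ℕ := Option.elim' (g t) (fun _ => t)
    obtain ⟨x2, hx2⟩ := (hp x1).1 rfl
    obtain ⟨y, hy, hc⟩ := h2 (Sum.elim x1 x2)
    have hval := h1 y hy _ hc
    refine ⟨Sum.elim y (Sum.elim (fun i => (i : ℕ)) fun b => if b then 1 else g t),
      hy, rfl, rfl, fun i => rfl, fun i hi => ?_, fun i hi => ?_, fun i j hij => ?_, ?_⟩
    · have := hc i _ hi
      simpa [ch, x1] using this.symm
    · have := hc i _ hi
      simpa [ch, x1, out] using this.symm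
    · obtain ⟨s, hs⟩ := Option.ne_none_iff_exists'.1 hij.2
      have e1 := hc i s hs
      have e2 := hc j s (hij.1 ▸ hs)
      simp [ch, e1, e2]
    · have hval := hval.symm.trans hx2
      simp [ch]; omega
  -- transport to `Fin`
  have hcard : Fintype.card W = t + (Fintype.card V + 3) := by
    simp [W]; omega
  let e : W ≃ Fin (t + (Fintype.card V + 3)) := Fintype.equivFinOfCardEq hcard
  obtain ⟨S, hS⟩ := (hZ.reindex e).exists_eqn
  obtain ⟨y, hy⟩ := hex
  obtain ⟨z, hz, hle⟩ := fOmega1_spec _ S ⟨y ∘ e.symm, (hS _).2 (by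
    simpa [Function.comp_assoc] using hy)⟩
  have := hout _ ((hS z).1 hz)
  rw [← this]
  exact hle _

/-- running sum of `h` -/
def bigSum (h : ℕ → ℕ) (n : ℕ) : ℕ := Nat.rec 0 (fun y IH => IH + h y) n

theorem bigSum_computable {h : ℕ → ℕ} (hh : Computable h) : Computable (bigSum h) := by
  have : Computable₂ fun (_ : ℕ) (q : ℕ × ℕ) => q.2 + h q.1 :=
    (Primrec.nat_add.to_comp).comp (Computable.snd.comp Computable.snd)
      (hh.comp (Computable.fst.comp Computable.snd))
  exact Computable.nat_rec Computable.id (Computable.const 0) this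

theorem le_bigSum (h : ℕ → ℕ) {i n : ℕ} (hi : i < n) : h i ≤ bigSum h n := by
  induction n with
  | zero => omega
  | succ n ih =>
    change h i ≤ bigSum h n + h n
    rcases Nat.lt_succ_iff_lt_or_eq.1 hi with h1 | rfl
    · have := ih h1; omega
    · omega

theorem main (h : ℕ → ℕ) (hh : Computable h) (hb : ∀ n : ℕ, 0 < n → fOmega1 n ≤ h n) : False := by
  have hg : Computable fun t => bigSum h (t + t + 2) + 1 :=
    Computable.succ.comp ((bigSum_computable hh).comp
      (Computable.succ.comp (Computable.succ.comp
        ((Primrec.nat_add.to_comp).comp Computable.id Computable.id))))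
  obtain ⟨c, hc⟩ := lower_bound hg
  have h1 := hc (c + 1)
  have h2 := hb (c + 1 + c) (by omega)
  have h3 := le_bigSum h (show c + 1 + c < c + 1 + (c + 1) + 2 by omega)
  omega

end H10

theorem stmt_19 :
    ¬ Computable fOmega1 ∧
    ¬ ∃ h : ℕ → ℕ, Computable h ∧ ∀ n : ℕ, 0 < n → fOmega1 n ≤ h n :=
  ⟨fun h => H10.main _ h fun _ _ => le_rfl, fun ⟨h, hh, hb⟩ => H10.main h hh hb⟩
end
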